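/- Let (k, m) be a balanced pair of generation n, let x_0 = k/2^{2m}, and define the truncated interval set X(x_0) = I(k, m) \ ∪ (k′/2^{2m′}, (k′+1)/2^{2m′}), the union taken over all balanced pairs (k′, m′) of generation n+1. Then (i) f(X(x_0)) is an interval of Lebesgue measure (1/2)(1/4)^m, and (ii) if y ∈ ℝ is not of the form f(k′/2^{2m′}) for any balanced pair (k′, m′) of generation n+1, then the set {x ∈ X(x_0) : f(x) = y} contains at most 2 points. -/

import Mathlib

/-- `phi x` is the distance from `x` to the nearest integer. -/
noncomputable def phi (x : ℝ) : ℝ := |x - round x|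

/-- The signed Takagi function associated to the sign sequence `r`. -/
noncomputable def takagi (r : ℕ → ℝ) (x : ℝ) : ℝ :=
  ∑' n : ℕ, r n / 2 ^ n * phi (2 ^ n * x)

/-- `eps n x` is the `n`-th binary digit of `x ∈ [0,1)` (for `n ≥ 1`), using the
terminating expansion for dyadic rationals. -/
noncomputable def eps (n : ℕ) (x : ℝ) : ℕ := (⌊2 ^ n * x⌋ % 2).toNat

/-- `Dfun r k x = ∑_{j=1}^k r_{j-1} (-1)^{ε_j(x)}`. -/
noncomputable def Dfun (r : ℕ → ℝ) (k : ℕ) (x : ℝ) : ℝ :=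
  ∑ j ∈ Finset.Icc 1 k, r (j - 1) * (-1 : ℝ) ^ eps j x

/-- `(k, m)` is a balanced pair if `0 ≤ k < 2^{2m}` and `D_{2m}(k/2^{2m}) = 0`. -/
def BalancedPair (r : ℕ → ℝ) (k m : ℕ) : Prop :=
  k < 2 ^ (2 * m) ∧ Dfun r (2 * m) ((k : ℝ) / 2 ^ (2 * m)) = 0

/-- The generation of a balanced pair `(k, m)`: the number of indices
`1 ≤ j ≤ 2m` with `D_j(k/2^{2m}) = 0`. -/
noncomputable def generation (r : ℕ → ℝ) (k m : ℕ) : ℕ :=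
  {j : ℕ | 1 ≤ j ∧ j ≤ 2 * m ∧ Dfun r j ((k : ℝ) / 2 ^ (2 * m)) = 0}.ncard

/-- The truncated interval set `X(x₀)` of a balanced pair `(k, m)` of generation
`n`: the interval `I(k, m)` minus the open intervals of all balanced pairs of
generation `n + 1`. -/
noncomputable def XtSet (r : ℕ → ℝ) (k m n : ℕ) : Set ℝ :=
  Set.Icc ((k : ℝ) / 2 ^ (2 * m)) (((k : ℝ) + 1) / 2 ^ (2 * m)) \
    ⋃ p : ℕ × ℕ, ⋃ _ : BalancedPair r p.1 p.2 ∧ generation r p.1 p.2 = n + 1,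
      Set.Ioo ((p.1 : ℝ) / 2 ^ (2 * p.2)) (((p.1 : ℝ) + 1) / 2 ^ (2 * p.2))

/-- The walk with steps `± r i`, the signs being read off the `N` binary digits of `k`. -/
noncomputable def signedWalk (r : ℕ → ℝ) (N k : ℕ) : ℝ :=
  ∑ i ∈ Finset.range N, r i * (-1) ^ (k / 2 ^ (N - 1 - i))

/-- The walk started at `d` and driven by the digits of `k` reaches `0` for the first time at
step `N`. -/
def IsFirstHit (d : ℝ) (r : ℕ → ℝ) (N k : ℕ) : Prop :=
  k < 2 ^ N ∧ d + signedWalk r N k = 0 ∧ ∀ j < N, d + signedWalk r j (k / 2 ^ (N - j)) ≠ 0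

/-- The points of `[0, 1]` outside all open dyadic intervals of first hits. -/
def Survives (d : ℝ) (r : ℕ → ℝ) (x : ℝ) : Prop :=
  0 ≤ x ∧ x ≤ 1 ∧ ∀ N k, IsFirstHit d r N k → ¬ ((k : ℝ) < 2 ^ N * x ∧ 2 ^ N * x < k + 1)

/-- The signed Takagi function plus a linear term of slope `d`. -/
noncomputable def tiltedTakagi (d : ℝ) (r : ℕ → ℝ) (x : ℝ) : ℝ := d * x + takagi r x

theorem signedWalk_add (r : ℕ → ℝ) (M N a k : ℕ) (hk : k < 2 ^ N) :
    signedWalk r (M + N) (a * 2 ^ N + k) =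
      signedWalk r M a + signedWalk (fun i => r (M + i)) N k := by
  unfold signedWalk
  rw [Finset.sum_range_add]
  congr 1
  · refine Finset.sum_congr rfl fun i hi => ?_
    have hi := Finset.mem_range.1 hi
    have h : M + N - 1 - i = N + (M - 1 - i) := by omega
    rw [h, pow_add, ← Nat.div_div_eq_div_mul, Nat.mul_comm a, Nat.mul_add_div (by positivity),
      Nat.div_eq_of_lt hk, add_zero]
  · refine Finset.sum_congr rfl fun i hi => ?_
    have hi := Finset.mem_range.1 hi
    have h : M + N - 1 - (M + i) = N - 1 - i := by omega
    have h2 : a * 2 ^ N = 2 ^ (N - 1 - i) * (2 * (2 ^ i * a)) := by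
      have : N = (N - 1 - i) + 1 + i := by omega
      conv_lhs => rw [this, pow_add, pow_add]
      ring
    rw [h, h2, Nat.mul_add_div (by positivity), pow_add, pow_mul]
    simp

theorem signedWalk_one (r : ℕ → ℝ) (a : ℕ) : signedWalk r 1 a = r 0 * (-1) ^ a := by
  simp [signedWalk]

theorem signedWalk_zero (r : ℕ → ℝ) (a : ℕ) : signedWalk r 0 a = 0 := by
  simp [signedWalk]

theorem signedWalk_const_mul (c : ℝ) (r : ℕ → ℝ) (N k : ℕ) :
    signedWalk (fun i => c * r i) N k = c * signedWalk r N k := by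
  simp [signedWalk, Finset.mul_sum, mul_assoc]

theorem signedWalk_add_div (r : ℕ → ℝ) (M N a q j : ℕ) (hq : q < 2 ^ N) (hj : j ≤ N) :
    signedWalk r (M + j) ((a * 2 ^ N + q) / 2 ^ (N - j)) =
      signedWalk r M a + signedWalk (fun i => r (M + i)) j (q / 2 ^ (N - j)) := by
  have h : a * 2 ^ N = 2 ^ (N - j) * (a * 2 ^ j) := by
    conv_lhs => rw [← Nat.sub_add_cancel hj, pow_add]
    ring
  rw [h, Nat.mul_add_div (by positivity)]
  refine signedWalk_add r M j a _ ?_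
  rw [Nat.div_lt_iff_lt_mul (by positivity), ← pow_add, Nat.add_sub_cancel' hj]
  exact hq

theorem add_div_two_pow_add {a N q : ℕ} (hq : q < 2 ^ N) (e : ℕ) :
    (a * 2 ^ N + q) / 2 ^ (N + e) = a / 2 ^ e := by
  rw [pow_add, ← Nat.div_div_eq_div_mul, Nat.mul_comm a, Nat.mul_add_div (by positivity),
      Nat.div_eq_of_lt hq, add_zero]

/-- A walk with steps `± 1` can only be at `0` at even times. -/
theorem even_of_signedWalk_eq_zero {r : ℕ → ℝ} (hr : ∀ n, r n = 1 ∨ r n = -1) {N k : ℕ}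
    (h : signedWalk r N k = 0) : Even N := by
  have key : ∀ s : ℕ → ℕ, ∀ N : ℕ, ∃ z : ℤ,
      ∑ i ∈ Finset.range N, r i * (-1 : ℝ) ^ s i = N + 2 * z := by
    intro s N
    induction N with
    | zero => exact ⟨0, by simp⟩
    | succ N ih =>
      obtain ⟨z, hz⟩ := ih
      rw [Finset.sum_range_succ, hz]
      rcases hr N with h1 | h1 <;> rcases neg_one_pow_eq_or ℝ (s N) with h2 | h2 <;> rw [h1, h2]
      · exact ⟨z, by push_cast; ring⟩
      · exact ⟨z - 1, by push_cast; ring⟩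
      · exact ⟨z - 1, by push_cast; ring⟩
      · exact ⟨z, by push_cast; ring⟩
  obtain ⟨z, hz⟩ := key (fun i => k / 2 ^ (N - 1 - i)) N
  have h3 : (N : ℝ) + 2 * z = 0 := hz.symm.trans h
  have h4 : (N : ℤ) + 2 * z = 0 := by exact_mod_cast h3
  rw [Nat.even_iff]
  omega

theorem eps_div_two_pow (k N j : ℕ) (hj : j ≤ N) :
    eps j ((k : ℝ) / 2 ^ N) = k / 2 ^ (N - j) % 2 := by
  have h : (2 : ℝ) ^ j * ((k : ℝ) / 2 ^ N) = ((k : ℕ) : ℝ) / ((2 ^ (N - j) : ℕ) : ℝ) := by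
    have : (2 : ℝ) ^ N = 2 ^ j * 2 ^ (N - j) := by rw [← pow_add, Nat.add_sub_cancel' hj]
    rw [this]; push_cast; field_simp
  unfold eps
  have h2 : ⌊((k : ℕ) : ℝ) / ((2 ^ (N - j) : ℕ) : ℝ)⌋ = ((k / 2 ^ (N - j) : ℕ) : ℤ) := by
    rw [← Int.natCast_floor_eq_floor (by positivity), Nat.floor_div_eq_div]
  rw [h, h2]
  omega

theorem Dfun_div_two_pow (r : ℕ → ℝ) (k N j : ℕ) (hj : j ≤ N) :
    Dfun r j ((k : ℝ) / 2 ^ N) = signedWalk r j (k / 2 ^ (N - j)) := by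
  unfold Dfun signedWalk
  rw [← Finset.Ico_add_one_right_eq_Icc, Finset.sum_Ico_eq_sum_range]
  refine Finset.sum_congr (by simp) fun i hi => ?_
  have hi := Finset.mem_range.1 hi
  rw [eps_div_two_pow _ _ _ (by omega), Nat.div_div_eq_div_mul, ← pow_add]
  have h1 : 1 + i - 1 = i := by omega
  have h2 : N - j + (j - 1 - i) = N - (1 + i) := by omega
  rw [h1, h2, ← neg_one_pow_eq_pow_mod_two]

/-- A closed dyadic interval determines the leading digits of the points of an open one that
meets it. -/
theorem eq_div_two_pow_of_mem {a k N : ℕ} {t : ℝ} (h0 : 0 ≤ t) (h1 : t ≤ 1)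
    (hl : (k : ℝ) < 2 ^ N * (a + t)) (hu : 2 ^ N * (a + t) < k + 1) : k / 2 ^ N = a := by
  have hp : (0 : ℝ) < 2 ^ N := by positivity
  refine Nat.div_eq_of_lt_le ?_ ?_
  · have : (a : ℝ) * 2 ^ N < k + 1 := by nlinarith
    exact Nat.lt_succ_iff.1 (by exact_mod_cast this)
  · have : (k : ℝ) < (a + 1) * 2 ^ N := by nlinarith
    exact_mod_cast this

theorem div_two_pow_eq_of_mem {a k N : ℕ} {t : ℝ} (h0 : 0 ≤ t) (h1 : t ≤ 1)
    (hl : (k : ℝ) * 2 ^ N < a + t) (hu : a + t < (k + 1) * 2 ^ N) : a / 2 ^ N = k := by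
  refine Nat.div_eq_of_lt_le ?_ ?_
  · have : (k : ℝ) * 2 ^ N < a + 1 := by linarith
    exact Nat.lt_succ_iff.1 (by exact_mod_cast this)
  · have : (a : ℝ) < (k + 1) * 2 ^ N := by linarith
    exact_mod_cast this

theorem isFirstHit_succ_iff {d : ℝ} (hd : d ≠ 0) (r : ℕ → ℝ) {N b q : ℕ} (hb : b ≤ 1)
    (hq : q < 2 ^ N) : IsFirstHit d r (N + 1) (b * 2 ^ N + q) ↔
      IsFirstHit (d + r 0 * (-1) ^ b) (fun i => r (1 + i)) N q := by
  have hw : ∀ j ≤ N, d + signedWalk r (j + 1) ((b * 2 ^ N + q) / 2 ^ (N + 1 - (j + 1))) =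
      d + r 0 * (-1) ^ b + signedWalk (fun i => r (1 + i)) j (q / 2 ^ (N - j)) := by
    intro j hj
    rw [show N + 1 - (j + 1) = N - j by omega, add_comm j 1,
      signedWalk_add_div r 1 N b q j hq hj, signedWalk_one]
    ring
  have hN := hw N le_rfl
  simp only [Nat.sub_self, pow_zero, Nat.div_one] at hN
  have hlt : b * 2 ^ N + q < 2 ^ (N + 1) := by
    rw [pow_succ]
    nlinarith [Nat.mul_le_mul_right (2 ^ N) hb]
  unfold IsFirstHit
  rw [hN]
  constructor
  · rintro ⟨-, h2, h3⟩
    exact ⟨hq, h2, fun j hj => by rw [← hw j hj.le]; exact h3 (j + 1) (by omega)⟩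
  · rintro ⟨-, h2, h3⟩
    refine ⟨hlt, h2, fun j hj => ?_⟩
    rcases j with _ | j
    · simpa [signedWalk_zero] using hd
    · rw [hw j (by omega)]
      exact h3 j (by omega)

theorem survives_half_iff {d : ℝ} (hd : d ≠ 0) (r : ℕ → ℝ) {b : ℕ} (hb : b ≤ 1) {t : ℝ}
    (h0 : 0 ≤ t) (h1 : t ≤ 1) : Survives d r ((b + t) / 2) ↔
      Survives (d + r 0 * (-1) ^ b) (fun i => r (1 + i)) t := by
  have hb' : (b : ℝ) ≤ 1 := by exact_mod_cast hb
  have hb0 : (0 : ℝ) ≤ b := by positivity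
  have hx : ∀ N : ℕ, (2 : ℝ) ^ (N + 1) * ((b + t) / 2) = 2 ^ N * (b + t) := by
    intro N; rw [pow_succ]; ring
  constructor
  · rintro ⟨-, -, h⟩
    refine ⟨h0, h1, fun N q hq hm => ?_⟩
    refine h _ _ ((isFirstHit_succ_iff hd r hb hq.1).2 hq) ?_
    rw [hx]
    push_cast
    exact ⟨by linarith [hm.1], by linarith [hm.2]⟩
  · rintro ⟨-, -, h⟩
    refine ⟨by positivity, by linarith, fun N k hk hm => ?_⟩
    rcases N with _ | N
    · exact hd (by simpa [signedWalk_zero] using hk.2.1)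
    rw [hx] at hm
    have hq := eq_div_two_pow_of_mem h0 h1 hm.1 hm.2
    have hk' : b * 2 ^ N + k % 2 ^ N = k := by rw [← hq]; exact Nat.div_add_mod' k (2 ^ N)
    have hlt : k % 2 ^ N < 2 ^ N := Nat.mod_lt _ (by positivity)
    rw [← hk'] at hk
    have hkr : (k : ℝ) = b * 2 ^ N + (k % 2 ^ N : ℕ) := by
      conv_lhs => rw [← hk']
      push_cast; ring
    refine h _ _ ((isFirstHit_succ_iff hd r hb hlt).1 hk) ?_
    rw [hkr] at hm
    exact ⟨by linarith [hm.1], by linarith [hm.2]⟩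

theorem isFirstHit_zero (r : ℕ → ℝ) : IsFirstHit 0 r 0 0 := by
  simp [IsFirstHit, signedWalk_zero]

theorem Survives.eq_zero_or_eq_one {r : ℕ → ℝ} {x : ℝ} (h : Survives 0 r x) :
    x = 0 ∨ x = 1 := by
  have h2 := h.2.2 0 0 (isFirstHit_zero r)
  simp only [Nat.cast_zero, pow_zero, one_mul, zero_add, not_and, not_lt] at h2
  rcases h.1.lt_or_eq with h0 | h0
  · exact Or.inr (le_antisymm h.2.1 (h2 h0))
  · exact Or.inl h0.symm

theorem survives_zero (d : ℝ) (r : ℕ → ℝ) : Survives d r 0 := by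
  refine ⟨le_rfl, zero_le_one, fun N k _ h => ?_⟩
  have : (0 : ℝ) ≤ k := by positivity
  linarith [h.1]

theorem survives_one (d : ℝ) (r : ℕ → ℝ) : Survives d r 1 := by
  refine ⟨zero_le_one, le_rfl, fun N k hk h => ?_⟩
  have : (k : ℝ) + 1 ≤ 2 ^ N := by exact_mod_cast hk.1
  linarith [h.2]

theorem isClosed_survives (d : ℝ) (r : ℕ → ℝ) : IsClosed {x | Survives d r x} := by
  simp only [Survives, Set.ofPred_and, Set.ofPred_forall]
  refine (isClosed_le continuous_const continuous_id).inter
    ((isClosed_le continuous_id continuous_const).inter ?_)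
  refine isClosed_iInter fun N => isClosed_iInter fun k => isClosed_iInter fun _ => ?_
  rw [← isOpen_compl_iff]
  have : {x : ℝ | ¬ ((k : ℝ) < 2 ^ N * x ∧ 2 ^ N * x < k + 1)}ᶜ =
      {x : ℝ | (k : ℝ) < 2 ^ N * x} ∩ {x : ℝ | 2 ^ N * x < k + 1} := by
    ext x; simp
  rw [this]
  exact (isOpen_lt (by fun_prop) (by fun_prop)).inter (isOpen_lt (by fun_prop) (by fun_prop))

theorem phi_eq_norm (x : ℝ) : phi x = ‖(x : UnitAddCircle)‖ := (UnitAddCircle.norm_eq).symm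

theorem continuous_phi : Continuous phi := by
  have : phi = fun x : ℝ => ‖(x : UnitAddCircle)‖ := funext phi_eq_norm
  rw [this]
  exact continuous_norm.comp (AddCircle.continuous_mk' 1)

theorem phi_nonneg (x : ℝ) : 0 ≤ phi x := abs_nonneg _

theorem phi_le_half (x : ℝ) : phi x ≤ 1 / 2 := abs_sub_round x

theorem phi_add_natCast (x : ℝ) (n : ℕ) : phi (x + n) = phi x := by
  simp [phi, round_add_natCast]

theorem phi_of_le_half {x : ℝ} (h0 : 0 ≤ x) (h1 : x ≤ 1 / 2) : phi x = x := by
  rw [phi, abs_sub_round_eq_min, Int.fract_eq_self.2 ⟨h0, by linarith⟩]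
  exact min_eq_left (by linarith)

theorem phi_half_add {x : ℝ} (h0 : 0 ≤ x) (h1 : x ≤ 1 / 2) : phi (1 / 2 + x) = 1 / 2 - x := by
  rcases h1.lt_or_eq with h | h
  · rw [phi, abs_sub_round_eq_min, Int.fract_eq_self.2 ⟨by linarith, by linarith⟩]
    rw [min_eq_right (by linarith)]
    ring
  · subst h
    have := phi_add_natCast 0 1
    rw [phi_of_le_half le_rfl (by norm_num)] at this
    norm_num at this ⊢
    exact this

theorem phi_add_div_two_pow (M a : ℕ) {t : ℝ} (h0 : 0 ≤ t) (h1 : t ≤ 1) :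
    phi ((a + t) / 2 ^ (M + 1)) =
      phi (a / 2 ^ (M + 1)) + (-1) ^ (a / 2 ^ M) * (t / 2 ^ (M + 1)) := by
  set q := a / 2 ^ M with hq
  set s := a % 2 ^ M with hs
  have ha : (a : ℝ) = q * 2 ^ M + s := by
    exact_mod_cast (Nat.div_add_mod' a (2 ^ M)).symm
  have hsl : (s : ℝ) + 1 ≤ 2 ^ M := by
    exact_mod_cast Nat.mod_lt a (show 0 < 2 ^ M by positivity)
  have hs0 : (0 : ℝ) ≤ s := by positivity
  have hp : (0 : ℝ) < 2 ^ M := by positivity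
  have hu : ∀ u : ℝ, 0 ≤ u → u ≤ 1 → 0 ≤ (s + u) / 2 ^ (M + 1) ∧
      (s + u) / 2 ^ (M + 1) ≤ 1 / 2 := by
    intro u hu0 hu1
    refine ⟨by positivity, ?_⟩
    rw [div_le_iff₀ (by positivity), pow_succ]
    linarith
  have hphi : ∀ u : ℝ, 0 ≤ u → u ≤ 1 → phi ((a + u) / 2 ^ (M + 1)) =
      (if Even q then 0 else 1 / 2) + (-1) ^ q * ((s + u) / 2 ^ (M + 1)) := by
    intro u hu0 hu1
    obtain ⟨hl, hr⟩ := hu u hu0 hu1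
    rcases Nat.even_or_odd q with he | ho
    · rw [if_pos he, he.neg_one_pow]
      obtain ⟨c, hc⟩ := he
      have : ((a : ℝ) + u) / 2 ^ (M + 1) = (s + u) / 2 ^ (M + 1) + c := by
        rw [ha, hc, pow_succ]; push_cast; field_simp; ring
      rw [this, phi_add_natCast, phi_of_le_half hl hr]
      ring
    · rw [if_neg (Nat.not_even_iff_odd.2 ho), ho.neg_one_pow]
      obtain ⟨c, hc⟩ := ho
      have : ((a : ℝ) + u) / 2 ^ (M + 1) = 1 / 2 + (s + u) / 2 ^ (M + 1) + c := by
        rw [ha, hc, pow_succ]; push_cast; field_simp; ring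
      rw [this, phi_add_natCast, phi_half_add hl hr]
      ring
  have h2 := hphi 0 le_rfl zero_le_one
  rw [add_zero] at h2
  rw [hphi t h0 h1, h2]
  ring

theorem abs_eq_one {r : ℕ → ℝ} (hr : ∀ n, r n = 1 ∨ r n = -1) (n : ℕ) : |r n| = 1 := by
  rcases hr n with h | h <;> simp [h]

theorem norm_takagi_term_le {r : ℕ → ℝ} (hr : ∀ n, r n = 1 ∨ r n = -1) (x : ℝ) (n : ℕ) :
    ‖r n / 2 ^ n * phi (2 ^ n * x)‖ ≤ 1 / 2 / 2 ^ n := by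
  rw [norm_mul, norm_div, Real.norm_eq_abs, abs_eq_one hr, Real.norm_of_nonneg (phi_nonneg _),
    norm_pow, Real.norm_ofNat, div_mul_eq_mul_div, one_mul]
  gcongr
  exact phi_le_half _

theorem summable_takagi {r : ℕ → ℝ} (hr : ∀ n, r n = 1 ∨ r n = -1) (x : ℝ) :
    Summable fun n => r n / 2 ^ n * phi (2 ^ n * x) :=
  Summable.of_norm_bounded (summable_geometric_two' 1) (norm_takagi_term_le hr x)

theorem abs_takagi_le_one {r : ℕ → ℝ} (hr : ∀ n, r n = 1 ∨ r n = -1) (x : ℝ) :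
    |takagi r x| ≤ 1 :=
  tsum_of_norm_bounded (hasSum_geometric_two' 1) (norm_takagi_term_le hr x)

theorem continuous_takagi {r : ℕ → ℝ} (hr : ∀ n, r n = 1 ∨ r n = -1) : Continuous (takagi r) := by
  refine continuous_tsum (fun n => ?_) (summable_geometric_two' 1)
    (fun n x => norm_takagi_term_le hr x n)
  exact continuous_const.mul (continuous_phi.comp (by fun_prop))

theorem takagi_eq_add {r : ℕ → ℝ} (hr : ∀ n, r n = 1 ∨ r n = -1) (x : ℝ) :
    takagi r x = r 0 * phi x + 1 / 2 * takagi (fun n => r (n + 1)) (2 * x) := by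
  unfold takagi
  rw [(summable_takagi hr x).tsum_eq_zero_add, ← tsum_mul_left]
  congr 1
  · simp
  · refine tsum_congr fun n => ?_
    rw [pow_succ, mul_assoc ((2 : ℝ) ^ n) 2 x]
    field_simp

theorem takagi_add_natCast (r : ℕ → ℝ) (x : ℝ) (a : ℕ) : takagi r (x + a) = takagi r x := by
  refine tsum_congr fun n => ?_
  have : (2 : ℝ) ^ n * (x + a) = 2 ^ n * x + ((2 ^ n * a : ℕ) : ℝ) := by push_cast; ring
  rw [this, phi_add_natCast]

theorem takagi_zero (r : ℕ → ℝ) : takagi r 0 = 0 := by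
  simp [takagi, phi]

theorem takagi_one (r : ℕ → ℝ) : takagi r 1 = 0 := by
  have := takagi_add_natCast r 0 1
  simpa [takagi_zero] using this

theorem takagi_const_mul (c : ℝ) (r : ℕ → ℝ) (x : ℝ) :
    takagi (fun i => c * r i) x = c * takagi r x := by
  unfold takagi
  rw [← tsum_mul_left]
  exact tsum_congr fun n => by ring

/-- Self-affinity of the signed Takagi function on dyadic intervals. -/
theorem takagi_add_div_two_pow {r : ℕ → ℝ} (hr : ∀ n, r n = 1 ∨ r n = -1) (M a : ℕ) {t : ℝ}
    (h0 : 0 ≤ t) (h1 : t ≤ 1) :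
    takagi r ((a + t) / 2 ^ M) = takagi r (a / 2 ^ M) +
      (signedWalk r M a * t + takagi (fun i => r (M + i)) t) / 2 ^ M := by
  induction M generalizing r with
  | zero =>
    have h := takagi_add_natCast r 0 a
    rw [zero_add, takagi_zero] at h
    simp [signedWalk_zero, h, add_comm (a : ℝ) t, takagi_add_natCast]
  | succ M ih =>
    have hs : ∀ x : ℝ, 2 * (x / 2 ^ (M + 1)) = x / 2 ^ M := by
      intro x; rw [pow_succ]; field_simp
    have hw : signedWalk r (M + 1) a =
        signedWalk (fun n => r (n + 1)) M a + r 0 * (-1) ^ (a / 2 ^ M) := by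
      unfold signedWalk
      rw [Finset.sum_range_succ']
      congr 1
      refine Finset.sum_congr rfl fun i hi => ?_
      rw [show M + 1 - 1 - (i + 1) = M - 1 - i by omega]
    have hf : (fun i => r (M + i + 1)) = fun i => r (M + 1 + i) :=
      funext fun i => by rw [add_right_comm]
    rw [takagi_eq_add hr, takagi_eq_add hr (a / 2 ^ (M + 1)), hs, hs,
      ih (fun n => hr (n + 1)), phi_add_div_two_pow M a h0 h1, hw, hf, pow_succ]
    field_simp
    ring

theorem tiltedTakagi_half {r : ℕ → ℝ} (hr : ∀ n, r n = 1 ∨ r n = -1) (d : ℝ) {b : ℕ}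
    (hb : b ≤ 1) {t : ℝ} (h0 : 0 ≤ t) (h1 : t ≤ 1) :
    tiltedTakagi d r ((b + t) / 2) = b * ((d + r 0) / 2) +
      1 / 2 * tiltedTakagi (d + r 0 * (-1) ^ b) (fun i => r (1 + i)) t := by
  have h := takagi_add_div_two_pow hr 1 b h0 h1
  have h2 := takagi_add_div_two_pow hr 1 0 zero_le_one le_rfl
  rw [signedWalk_one, pow_one] at h h2
  simp only [Nat.cast_zero, zero_add, zero_div, takagi_zero, takagi_one, pow_zero] at h2
  unfold tiltedTakagi
  rw [h]
  interval_cases b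
  · simp only [Nat.cast_zero, zero_div, takagi_zero]
    ring
  · rw [Nat.cast_one, h2]
    ring

theorem exists_natCast_eq_add {r : ℕ → ℝ} (hr : ∀ n, r n = 1 ∨ r n = -1) {d : ℕ} (hd : d ≠ 0)
    (b : ℕ) : ∃ e : ℕ, (e : ℝ) = d + r 0 * (-1) ^ b := by
  obtain ⟨d, rfl⟩ := Nat.exists_eq_succ_of_ne_zero hd
  have h : r 0 * (-1) ^ b = 1 ∨ r 0 * (-1) ^ b = -1 := by
    rcases hr 0 with h | h <;> rcases neg_one_pow_eq_or ℝ b with h2 | h2 <;> simp [h, h2]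
  rcases h with h | h <;> rw [h]
  · exact ⟨d + 2, by push_cast; ring⟩
  · exact ⟨d, by push_cast; ring⟩

theorem exists_half_eq {x : ℝ} (h0 : 0 ≤ x) (h1 : x ≤ 1) :
    ∃ b : ℕ, b ≤ 1 ∧ ∃ t : ℝ, 0 ≤ t ∧ t ≤ 1 ∧ x = (b + t) / 2 := by
  rcases le_total x (1 / 2) with h | h
  · exact ⟨0, zero_le_one, 2 * x, by linarith, by linarith, by push_cast; ring⟩
  · exact ⟨1, le_rfl, 2 * x - 1, by linarith, by linarith, by push_cast; ring⟩

theorem Survives.exists_half {r : ℕ → ℝ} (hr : ∀ n, r n = 1 ∨ r n = -1) {d : ℕ} (hd : d ≠ 0)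
    {x : ℝ} (h : Survives d r x) : ∃ b : ℕ, b ≤ 1 ∧ ∃ (e : ℕ) (t : ℝ),
      (e : ℝ) = d + r 0 * (-1) ^ b ∧ x = (b + t) / 2 ∧ Survives e (fun i => r (1 + i)) t ∧
      tiltedTakagi d r x =
        b * ((d + r 0) / 2) + 1 / 2 * tiltedTakagi e (fun i => r (1 + i)) t := by
  obtain ⟨b, hb, t, h0, h1, rfl⟩ := exists_half_eq h.1 h.2.1
  obtain ⟨e, he⟩ := exists_natCast_eq_add hr hd b
  refine ⟨b, hb, e, t, he, rfl, ?_, ?_⟩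
  · rw [he]
    exact (survives_half_iff (Nat.cast_ne_zero.2 hd) r hb h0 h1).1 h
  · rw [he]
    exact tiltedTakagi_half hr d hb h0 h1

theorem tiltedTakagi_zero (d : ℝ) (r : ℕ → ℝ) : tiltedTakagi d r 0 = 0 := by
  simp [tiltedTakagi, takagi_zero]

theorem tiltedTakagi_one (d : ℝ) (r : ℕ → ℝ) : tiltedTakagi d r 1 = d := by
  simp [tiltedTakagi, takagi_one]

theorem one_le_natCast_and_abs_le {r : ℕ → ℝ} (hr : ∀ n, r n = 1 ∨ r n = -1) {d : ℕ}
    (hd : d ≠ 0) : (1 : ℝ) ≤ d ∧ -1 ≤ r 0 ∧ r 0 ≤ 1 := by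
  refine ⟨by exact_mod_cast Nat.one_le_iff_ne_zero.2 hd, ?_⟩
  rcases hr 0 with h | h <;> rw [h] <;> norm_num

theorem tiltedTakagi_approx_mem_Icc (N : ℕ) : ∀ {r : ℕ → ℝ}, (∀ n, r n = 1 ∨ r n = -1) →
    ∀ {d : ℕ} {x : ℝ}, Survives d r x →
      -(1 / 2 ^ N) ≤ tiltedTakagi d r x ∧ tiltedTakagi d r x ≤ d + 1 / 2 ^ N := by
  induction N with
  | zero =>
    intro r hr d x h
    have h2 := abs_le.1 (abs_takagi_le_one hr x)
    have h3 : (0 : ℝ) ≤ d * x := mul_nonneg (by positivity) h.1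
    have h4 : (d : ℝ) * x ≤ d := mul_le_of_le_one_right (by positivity) h.2.1
    unfold tiltedTakagi
    norm_num
    constructor <;> linarith [h2.1, h2.2]
  | succ N ih =>
    intro r hr d x h
    have hp : (0 : ℝ) < 1 / 2 ^ N := by positivity
    have hp' : (1 : ℝ) / 2 ^ (N + 1) = 1 / 2 ^ N / 2 := by rw [pow_succ]; field_simp
    rw [hp']
    rcases eq_or_ne d 0 with rfl | hd
    · rw [Nat.cast_zero] at h ⊢
      rcases h.eq_zero_or_eq_one with rfl | rfl
      · rw [tiltedTakagi_zero]; constructor <;> linarith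
      · rw [tiltedTakagi_one]; constructor <;> linarith
    · obtain ⟨b, hb, e, t, he, -, hs, hf⟩ := h.exists_half hr hd
      have h2 := ih (fun n => hr (1 + n)) hs
      obtain ⟨h3, h4, h5⟩ := one_le_natCast_and_abs_le hr hd
      rw [hf]
      generalize (1 : ℝ) / 2 ^ N = ε at hp h2 ⊢
      interval_cases b <;> norm_num at he ⊢ <;> constructor <;> linarith [h2.1, h2.2]

theorem le_of_forall_le_add_div_two_pow {a b c : ℝ} (h : ∀ N : ℕ, a ≤ b + c / 2 ^ N) :
    a ≤ b := by
  have hc : Filter.Tendsto (fun N : ℕ => b + c / 2 ^ N) Filter.atTop (nhds (b + 0)) := by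
    refine tendsto_const_nhds.add ?_
    have := (tendsto_pow_atTop_nhds_zero_of_lt_one (r := (1 / 2 : ℝ)) (by norm_num)
      (by norm_num)).const_mul c
    rw [mul_zero] at this
    refine this.congr fun N => ?_
    rw [div_pow, one_pow, mul_one_div]
  rw [add_zero] at hc
  exact ge_of_tendsto' hc h

theorem tiltedTakagi_mem_Icc {r : ℕ → ℝ} (hr : ∀ n, r n = 1 ∨ r n = -1) {d : ℕ} {x : ℝ}
    (h : Survives d r x) : 0 ≤ tiltedTakagi d r x ∧ tiltedTakagi d r x ≤ d := by
  constructor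
  · refine le_of_forall_le_add_div_two_pow (c := 1) fun N => ?_
    linarith [(tiltedTakagi_approx_mem_Icc N hr h).1]
  · exact le_of_forall_le_add_div_two_pow fun N => (tiltedTakagi_approx_mem_Icc N hr h).2

theorem tiltedTakagi_approx_mono (N : ℕ) : ∀ {r : ℕ → ℝ}, (∀ n, r n = 1 ∨ r n = -1) →
    ∀ {d : ℕ} {x x' : ℝ}, Survives d r x → Survives d r x' → x ≤ x' →
      tiltedTakagi d r x ≤ tiltedTakagi d r x' + 2 / 2 ^ N := by
  induction N with
  | zero =>
    intro r hr d x x' h h' hle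
    have h2 := abs_le.1 (abs_takagi_le_one hr x)
    have h3 := abs_le.1 (abs_takagi_le_one hr x')
    have h4 : (d : ℝ) * x ≤ d * x' := by gcongr
    unfold tiltedTakagi
    norm_num
    linarith [h2.2, h3.1]
  | succ N ih =>
    intro r hr d x x' h h' hle
    have hp : (0 : ℝ) < 2 / 2 ^ N := by positivity
    have hp' : (2 : ℝ) / 2 ^ (N + 1) = 2 / 2 ^ N / 2 := by rw [pow_succ]; field_simp
    rw [hp']
    rcases eq_or_ne d 0 with rfl | hd
    · have h1 := tiltedTakagi_mem_Icc hr h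
      have h2 := tiltedTakagi_mem_Icc hr h'
      rw [Nat.cast_zero] at h1 h2 ⊢
      linarith [h1.2, h2.1]
    · obtain ⟨b, hb, e, t, he, hx, hs, hf⟩ := h.exists_half hr hd
      obtain ⟨b', hb', e', t', he', hx', hs', hf'⟩ := h'.exists_half hr hd
      have h1 := tiltedTakagi_mem_Icc (fun n => hr (1 + n)) hs
      have h2 := tiltedTakagi_mem_Icc (fun n => hr (1 + n)) hs'
      rw [hf, hf']
      rcases lt_trichotomy b b' with hlt | rfl | hgt
      · obtain ⟨rfl, rfl⟩ : b = 0 ∧ b' = 1 := by omega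
        norm_num at he he' ⊢
        linarith [h1.2, h2.1]
      · obtain rfl : e = e' := by
          have : (e : ℝ) = e' := he.trans he'.symm
          exact_mod_cast this
        have := ih (fun n => hr (1 + n)) hs hs' (by linarith)
        linarith
      · obtain ⟨rfl, rfl⟩ : b = 1 ∧ b' = 0 := by omega
        norm_num at hx hx'
        have ht : t = 0 := le_antisymm (by linarith [hs'.2.1]) hs.1
        have ht' : t' = 1 := le_antisymm hs'.2.1 (by linarith [hs.1])
        rw [ht, ht', tiltedTakagi_zero, tiltedTakagi_one]
        norm_num at he' ⊢
        linarith

theorem tiltedTakagi_mono {r : ℕ → ℝ} (hr : ∀ n, r n = 1 ∨ r n = -1) {d : ℕ} {x x' : ℝ}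
    (h : Survives d r x) (h' : Survives d r x') (hle : x ≤ x') :
    tiltedTakagi d r x ≤ tiltedTakagi d r x' :=
  le_of_forall_le_add_div_two_pow fun N => tiltedTakagi_approx_mono N hr h h' hle

theorem exists_isFirstHit_lift {r : ℕ → ℝ} {d : ℝ} (hd : d ≠ 0) {b N q : ℕ} (hb : b ≤ 1)
    (hq : IsFirstHit (d + r 0 * (-1) ^ b) (fun i => r (1 + i)) N q)
    (hs : Survives (d + r 0 * (-1) ^ b) (fun i => r (1 + i)) (q / 2 ^ N)) :
    ∃ N' q', IsFirstHit d r N' q' ∧ Survives d r (q' / 2 ^ N') ∧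
      (q' : ℝ) / 2 ^ N' = (b + q / 2 ^ N) / 2 := by
  have he : ((b * 2 ^ N + q : ℕ) : ℝ) / 2 ^ (N + 1) = (b + q / 2 ^ N) / 2 := by
    rw [pow_succ]; push_cast; field_simp
  refine ⟨N + 1, b * 2 ^ N + q, (isFirstHit_succ_iff hd r hb hq.1).2 hq, ?_, he⟩
  rw [he]
  exact (survives_half_iff hd r hb hs.1 hs.2.1).2 hs

theorem exists_isFirstHit (d : ℕ) : ∀ {r : ℕ → ℝ}, (∀ n, r n = 1 ∨ r n = -1) →
    ∃ N q, IsFirstHit d r N q ∧ Survives d r (q / 2 ^ N) := by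
  induction d with
  | zero =>
    intro r hr
    refine ⟨0, 0, by simpa using isFirstHit_zero r, by simpa using survives_zero 0 r⟩
  | succ d ih =>
    intro r hr
    obtain ⟨b, hb, hrb⟩ : ∃ b : ℕ, b ≤ 1 ∧ r 0 * (-1) ^ b = -1 := by
      rcases hr 0 with h | h
      · exact ⟨1, le_rfl, by simp [h]⟩
      · exact ⟨0, zero_le_one, by simp [h]⟩
    obtain ⟨N, q, hq, hs⟩ := ih (fun n => hr (1 + n))
    have hd : (d : ℝ) = (d + 1 : ℕ) + r 0 * (-1) ^ b := by rw [hrb]; push_cast; ring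
    rw [hd] at hq hs
    obtain ⟨N', q', h1, h2, -⟩ := exists_isFirstHit_lift (by positivity) hb hq hs
    exact ⟨N', q', h1, h2⟩

theorem exists_isFirstHit_between_dyadic (N : ℕ) : ∀ {r : ℕ → ℝ}, (∀ n, r n = 1 ∨ r n = -1) →
    ∀ {d j : ℕ} {x x' : ℝ}, Survives d r x → Survives d r x' → j < 2 ^ N → 2 ^ N * x ≤ j →
      (j + 1 : ℝ) ≤ 2 ^ N * x' → ∃ M q, IsFirstHit d r M q ∧ Survives d r (q / 2 ^ M) ∧
        x ≤ q / 2 ^ M ∧ (q : ℝ) / 2 ^ M ≤ x' := by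
  induction N with
  | zero =>
    intro r hr d j x x' h h' hj hx hx'
    obtain ⟨M, q, hq, hs⟩ := exists_isFirstHit d hr
    obtain rfl : j = 0 := by omega
    norm_num at hx hx'
    exact ⟨M, q, hq, hs, hx.trans hs.1, hs.2.1.trans hx'⟩
  | succ N ih =>
    intro r hr d j x x' h h' hj hx hx'
    rcases eq_or_ne d 0 with rfl | hd
    · refine ⟨0, 0, by simpa using isFirstHit_zero r, by simpa using survives_zero 0 r, ?_, ?_⟩
      · rw [Nat.cast_zero] at h
        rcases h.eq_zero_or_eq_one with rfl | rfl
        · simp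
        · have : (j : ℝ) < 2 ^ (N + 1) := by exact_mod_cast hj
          linarith
      · simpa using h'.1
    · have hd' : (d : ℝ) ≠ 0 := Nat.cast_ne_zero.2 hd
      have hP : (0 : ℝ) < 2 ^ N := by positivity
      set b := j / 2 ^ N with hb
      have hlt : j % 2 ^ N < 2 ^ N := Nat.mod_lt _ (by positivity)
      have hjr : (j : ℝ) = b * 2 ^ N + (j % 2 ^ N : ℕ) := by
        exact_mod_cast (Nat.div_add_mod' j (2 ^ N)).symm
      have hlt' : ((j % 2 ^ N : ℕ) : ℝ) + 1 ≤ 2 ^ N := by exact_mod_cast hlt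
      have hge' : (0 : ℝ) ≤ ((j % 2 ^ N : ℕ) : ℝ) := by positivity
      have hb1 : b ≤ 1 := by
        rw [← Nat.lt_succ_iff, hb, Nat.div_lt_iff_lt_mul (by positivity)]
        rwa [pow_succ, mul_comm] at hj
      rw [pow_succ, mul_assoc] at hx hx'
      have hu : 2 * x - b ≤ 1 := by
        by_contra! hc
        nlinarith
      have hl : 0 ≤ 2 * x' - b := by
        by_contra! hc
        nlinarith
      obtain ⟨e, he⟩ := exists_natCast_eq_add hr hd b
      have hs : Survives e (fun i => r (1 + i)) (max (2 * x - b) 0) := by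
        rcases le_total (2 * x - b) 0 with h0 | h0
        · rw [max_eq_right h0]; exact survives_zero _ _
        · rw [max_eq_left h0, he, ← survives_half_iff hd' r hb1 h0 hu]
          convert h using 1; ring
      have hs' : Survives e (fun i => r (1 + i)) (min (2 * x' - b) 1) := by
        rcases le_total 1 (2 * x' - b) with h0 | h0
        · rw [min_eq_right h0]; exact survives_one _ _
        · rw [min_eq_left h0, he, ← survives_half_iff hd' r hb1 hl h0]
          convert h' using 1; ring
      have hle : 2 ^ N * max (2 * x - b) 0 ≤ ((j % 2 ^ N : ℕ) : ℝ) := by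
        rw [mul_max_of_nonneg _ _ hP.le]
        exact max_le (by linarith) (by linarith)
      have hle' : ((j % 2 ^ N : ℕ) : ℝ) + 1 ≤ 2 ^ N * min (2 * x' - b) 1 := by
        rw [mul_min_of_nonneg _ _ hP.le]
        exact le_min (by linarith) (by linarith)
      obtain ⟨M, q, hq, hqs, h1, h2⟩ := ih (fun n => hr (1 + n)) hs hs' hlt hle hle'
      rw [he] at hq hqs
      obtain ⟨M', q', h3, h4, h5⟩ := exists_isFirstHit_lift hd' hb1 hq hqs
      refine ⟨M', q', h3, h4, ?_, ?_⟩
      · rw [h5]; linarith [(le_max_left _ _).trans h1]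
      · rw [h5]; linarith [h2.trans (min_le_left _ _)]

/-- Two distinct surviving points are separated by a first-hit interval, whose left endpoint
survives as well. -/
theorem exists_isFirstHit_between {r : ℕ → ℝ} (hr : ∀ n, r n = 1 ∨ r n = -1) {d : ℕ}
    {x x' : ℝ} (h : Survives d r x) (h' : Survives d r x') (hlt : x < x') :
    ∃ M q, IsFirstHit d r M q ∧ Survives d r (q / 2 ^ M) ∧ x ≤ q / 2 ^ M ∧
      (q : ℝ) / 2 ^ M ≤ x' := by
  obtain ⟨N, hN⟩ := pow_unbounded_of_one_lt (2 / (x' - x)) (one_lt_two (α := ℝ))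
  rw [div_lt_iff₀ (by linarith)] at hN
  have hP : (0 : ℝ) < 2 ^ N := by positivity
  have h0 : 0 ≤ 2 ^ N * x := mul_nonneg hP.le h.1
  have h1 := Nat.ceil_lt_add_one h0
  have h2 : ((⌈2 ^ N * x⌉₊ : ℕ) : ℝ) + 1 ≤ 2 ^ N * x' := by linarith
  refine exists_isFirstHit_between_dyadic N hr h h' ?_ (Nat.le_ceil _) h2
  have h3 : ((⌈2 ^ N * x⌉₊ : ℕ) : ℝ) < 2 ^ N := by nlinarith [h'.2.1]
  exact_mod_cast h3

theorem exists_tiltedTakagi_approx (N : ℕ) : ∀ {r : ℕ → ℝ}, (∀ n, r n = 1 ∨ r n = -1) →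
    ∀ {d : ℕ} {y : ℝ}, 0 ≤ y → y ≤ d →
      ∃ x, Survives d r x ∧ |tiltedTakagi d r x - y| ≤ (d + N) / 2 ^ N := by
  induction N with
  | zero =>
    intro r hr d y h0 h1
    refine ⟨0, survives_zero _ _, ?_⟩
    rw [tiltedTakagi_zero, zero_sub, abs_neg, abs_of_nonneg h0]
    simpa using h1
  | succ N ih =>
    intro r hr d y h0 h1
    rcases eq_or_ne d 0 with rfl | hd
    · refine ⟨0, survives_zero _ _, ?_⟩
      rw [tiltedTakagi_zero, zero_sub, abs_neg, abs_of_nonneg h0]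
      exact h1.trans (by rw [Nat.cast_zero]; positivity)
    · obtain ⟨h3, h4, h5⟩ := one_le_natCast_and_abs_le hr hd
      obtain ⟨b, hb, hy0, hy1⟩ : ∃ b : ℕ, b ≤ 1 ∧ 0 ≤ 2 * (y - b * ((d + r 0) / 2)) ∧
          2 * (y - b * ((d + r 0) / 2)) ≤ d + r 0 * (-1) ^ b := by
        rcases le_total y ((d + r 0) / 2) with h | h
        · refine ⟨0, zero_le_one, ?_, ?_⟩ <;> norm_num <;> linarith
        · refine ⟨1, le_rfl, ?_, ?_⟩ <;> norm_num <;> linarith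
      obtain ⟨e, he⟩ := exists_natCast_eq_add hr hd b
      rw [← he] at hy1
      obtain ⟨t, ht, hty⟩ := ih (fun n => hr (1 + n)) hy0 hy1
      have hed : (e : ℝ) ≤ d + 1 := by
        interval_cases b <;> norm_num at he <;> linarith
      have hbound : ((e : ℝ) + N) / 2 ^ N / 2 ≤ (d + (N + 1 : ℕ)) / 2 ^ (N + 1) := by
        rw [div_div, ← pow_succ]
        push_cast
        gcongr ?_ / _
        linarith
      rw [he] at ht
      refine ⟨(b + t) / 2, (survives_half_iff (Nat.cast_ne_zero.2 hd) r hb ht.1 ht.2.1).2 ht, ?_⟩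
      rw [tiltedTakagi_half hr d hb ht.1 ht.2.1, ← he]
      refine le_trans ?_ hbound
      rw [abs_le] at hty ⊢
      constructor <;> linarith [hty.1, hty.2]

theorem exists_tiltedTakagi_eq {r : ℕ → ℝ} (hr : ∀ n, r n = 1 ∨ r n = -1) {d : ℕ} {y : ℝ}
    (h0 : 0 ≤ y) (h1 : y ≤ d) : ∃ x, Survives d r x ∧ tiltedTakagi d r x = y := by
  have hc : IsCompact {x | Survives d r x} :=
    isCompact_Icc.of_isClosed_subset (isClosed_survives d r)
      (fun x hx => (⟨hx.1, hx.2.1⟩ : x ∈ Set.Icc (0 : ℝ) 1))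
  have hcont : Continuous (tiltedTakagi d r) :=
    (continuous_const.mul continuous_id).add (continuous_takagi hr)
  have hcl := (hc.image hcont).isClosed
  have hmem : y ∈ closure (tiltedTakagi d r '' {x | Survives d r x}) := by
    rw [Metric.mem_closure_iff]
    intro ε hε
    have ht : Filter.Tendsto (fun N : ℕ => ((d : ℝ) + N) / 2 ^ N) Filter.atTop (nhds 0) := by
      have h2 := (tendsto_pow_const_div_const_pow_of_one_lt 0 (one_lt_two (α := ℝ))).const_mul
        (d : ℝ)
      have h3 := tendsto_pow_const_div_const_pow_of_one_lt 1 (one_lt_two (α := ℝ))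
      have h4 := h2.add h3
      rw [mul_zero, add_zero] at h4
      refine h4.congr fun N => ?_
      simp only [pow_zero, pow_one]
      ring
    obtain ⟨N, hN⟩ := (ht.eventually_lt_const hε).exists
    obtain ⟨x, hx, hxy⟩ := exists_tiltedTakagi_approx N hr h0 h1
    exact ⟨_, ⟨x, hx, rfl⟩, by rw [dist_comm, Real.dist_eq]; linarith⟩
  rw [hcl.closure_eq] at hmem
  exact hmem

theorem isFirstHit_const_mul_iff {c : ℝ} (hc : c ≠ 0) (d : ℝ) (r : ℕ → ℝ) (N k : ℕ) :
    IsFirstHit (c * d) (fun i => c * r i) N k ↔ IsFirstHit d r N k := by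
  simp only [IsFirstHit, signedWalk_const_mul, ← mul_add, mul_eq_zero, hc, false_or, ne_eq]

theorem isFirstHit_sign_iff {σ : ℝ} (hσ : σ = 1 ∨ σ = -1) {r : ℕ → ℝ}
    (N k : ℕ) :
    IsFirstHit (1 : ℕ) (fun i => σ * r i) N k ↔ IsFirstHit σ r N k := by
  have h : σ * σ = (1 : ℕ) := by rcases hσ with h | h <;> simp [h]
  rw [← h]
  exact isFirstHit_const_mul_iff (by rcases hσ with h | h <;> simp [h]) σ r N k

theorem survives_sign_iff {σ : ℝ} (hσ : σ = 1 ∨ σ = -1) {r : ℕ → ℝ}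
    (t : ℝ) :
    Survives (1 : ℕ) (fun i => σ * r i) t ↔ Survives σ r t := by
  unfold Survives
  simp only [isFirstHit_sign_iff hσ]

theorem tiltedTakagi_sign {σ : ℝ} (hσ : σ = 1 ∨ σ = -1) {r : ℕ → ℝ}
    (t : ℝ) :
    tiltedTakagi σ r t = σ * tiltedTakagi (1 : ℕ) (fun i => σ * r i) t := by
  unfold tiltedTakagi
  rw [takagi_const_mul]
  rcases hσ with rfl | rfl <;> push_cast <;> ring

theorem sign_mul_eq {σ : ℝ} (hσ : σ = 1 ∨ σ = -1) {r : ℕ → ℝ}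
    (hr : ∀ n, r n = 1 ∨ r n = -1) (n : ℕ) : σ * r n = 1 ∨ σ * r n = -1 := by
  rcases hσ with h | h <;> rcases hr n with h2 | h2 <;> simp [h, h2]

theorem Survives.exists_tiltedTakagi_eq_sign_mul {σ : ℝ} (hσ : σ = 1 ∨ σ = -1) {r : ℕ → ℝ}
    (hr : ∀ n, r n = 1 ∨ r n = -1) {t : ℝ}
    (h : Survives σ r t) : ∃ u, 0 ≤ u ∧ u ≤ 1 ∧ tiltedTakagi σ r t = σ * u := by
  rw [← survives_sign_iff hσ] at h
  have h2 := tiltedTakagi_mem_Icc (sign_mul_eq hσ hr) h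
  exact ⟨_, h2.1, by simpa using h2.2, tiltedTakagi_sign hσ t⟩

theorem exists_survives_tiltedTakagi_eq_sign_mul {σ : ℝ} (hσ : σ = 1 ∨ σ = -1) {r : ℕ → ℝ}
    (hr : ∀ n, r n = 1 ∨ r n = -1) {u : ℝ}
    (h0 : 0 ≤ u) (h1 : u ≤ 1) : ∃ t, Survives σ r t ∧ tiltedTakagi σ r t = σ * u := by
  obtain ⟨t, ht, htu⟩ := exists_tiltedTakagi_eq (sign_mul_eq hσ hr) (d := 1) h0 (by simpa using h1)
  refine ⟨t, (survives_sign_iff hσ t).1 ht, ?_⟩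
  rw [tiltedTakagi_sign hσ, htu]

theorem exists_isFirstHit_of_tiltedTakagi_eq {σ : ℝ} (hσ : σ = 1 ∨ σ = -1) {r : ℕ → ℝ}
    (hr : ∀ n, r n = 1 ∨ r n = -1) {t t' : ℝ}
    (h : Survives σ r t) (h' : Survives σ r t') (hlt : t < t')
    (he : tiltedTakagi σ r t = tiltedTakagi σ r t') : ∃ N q, IsFirstHit σ r N q ∧
      Survives σ r (q / 2 ^ N) ∧ tiltedTakagi σ r (q / 2 ^ N) = tiltedTakagi σ r t := by
  rw [← survives_sign_iff hσ] at h h'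
  rw [tiltedTakagi_sign hσ t, tiltedTakagi_sign hσ t'] at he
  have he := mul_left_cancel₀ (by rcases hσ with h | h <;> simp [h]) he
  have hr' := sign_mul_eq hσ hr
  obtain ⟨N, q, hq, hs, h1, h2⟩ := exists_isFirstHit_between hr' h h' hlt
  refine ⟨N, q, (isFirstHit_sign_iff hσ N q).1 hq, (survives_sign_iff hσ _).1 hs, ?_⟩
  rw [tiltedTakagi_sign hσ, tiltedTakagi_sign hσ t]
  congr 1
  exact le_antisymm ((tiltedTakagi_mono hr' hs h' h2).trans he.ge) (tiltedTakagi_mono hr' h hs h1)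

/-- The positive times at which the walk driven by the `N` digits of `k` is at `0`. -/
def zeroTimes (r : ℕ → ℝ) (N k : ℕ) : Set ℕ :=
  {j | 1 ≤ j ∧ j ≤ N ∧ signedWalk r j (k / 2 ^ (N - j)) = 0}

theorem finite_zeroTimes (r : ℕ → ℝ) (N k : ℕ) : (zeroTimes r N k).Finite :=
  (Set.finite_Iic N).subset fun _ hj => hj.2.1

theorem balancedPair_iff (r : ℕ → ℝ) (k m : ℕ) :
    BalancedPair r k m ↔ k < 2 ^ (2 * m) ∧ signedWalk r (2 * m) k = 0 := by
  unfold BalancedPair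
  rw [Dfun_div_two_pow _ _ _ _ le_rfl, Nat.sub_self, pow_zero, Nat.div_one]

theorem generation_eq_ncard (r : ℕ → ℝ) (k m : ℕ) :
    generation r k m = (zeroTimes r (2 * m) k).ncard := by
  unfold generation zeroTimes
  congr 1
  ext j
  simp only [Set.mem_ofPred_eq]
  constructor <;> rintro ⟨h1, h2, h3⟩ <;> refine ⟨h1, h2, ?_⟩
  · rwa [Dfun_div_two_pow _ _ _ _ h2] at h3
  · rwa [Dfun_div_two_pow _ _ _ _ h2]

section Concatenation

variable (r : ℕ → ℝ) {M k b N q : ℕ}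

theorem signedWalk_concat_of_le (hb : b ≤ 1) (hq : q < 2 ^ N) {j : ℕ} (hj : j ≤ M) :
    signedWalk r j (((2 * k + b) * 2 ^ N + q) / 2 ^ (M + 1 + N - j)) =
      signedWalk r j (k / 2 ^ (M - j)) := by
  rw [show M + 1 + N - j = N + (1 + (M - j)) by omega, add_div_two_pow_add hq, pow_add, pow_one,
    ← Nat.div_div_eq_div_mul, show (2 * k + b) / 2 = k by omega]

theorem signedWalk_two_mul_add (hb : b ≤ 1) (hk : signedWalk r M k = 0) :
    signedWalk r (M + 1) (2 * k + b) = r M * (-1) ^ b := by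
  have := signedWalk_add r M 1 k b (by omega)
  rw [pow_one, mul_comm k 2, hk, signedWalk_one, zero_add] at this
  exact this

theorem signedWalk_concat (hb : b ≤ 1) (hq : q < 2 ^ N) (hk : signedWalk r M k = 0) {j : ℕ}
    (hj : j ≤ N) :
    signedWalk r (M + 1 + j) (((2 * k + b) * 2 ^ N + q) / 2 ^ (M + 1 + N - (M + 1 + j))) =
      r M * (-1) ^ b + signedWalk (fun i => r (M + 1 + i)) j (q / 2 ^ (N - j)) := by
  rw [show M + 1 + N - (M + 1 + j) = N - j by omega, signedWalk_add_div r (M + 1) N _ q j hq hj,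
    signedWalk_two_mul_add r hb hk]

theorem insert_zeroTimes_subset (hb : b ≤ 1) (hq : q < 2 ^ N)
    (hz : signedWalk r (M + 1 + N) ((2 * k + b) * 2 ^ N + q) = 0) :
    insert (M + 1 + N) (zeroTimes r M k) ⊆
      zeroTimes r (M + 1 + N) ((2 * k + b) * 2 ^ N + q) := by
  rintro j (rfl | ⟨h1, h2, h3⟩)
  · exact ⟨by omega, le_rfl, by simpa using hz⟩
  · exact ⟨h1, by omega, by rwa [signedWalk_concat_of_le r hb hq h2]⟩

theorem ncard_insert_zeroTimes :
    (insert (M + 1 + N) (zeroTimes r M k)).ncard = (zeroTimes r M k).ncard + 1 :=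
  Set.ncard_insert_of_notMem (fun h => by have := h.2.1; omega) (finite_zeroTimes r M k)

theorem isFirstHit_iff_ncard_zeroTimes (hb : b ≤ 1) (hq : q < 2 ^ N)
    (hk : signedWalk r M k = 0) :
    IsFirstHit (r M * (-1) ^ b) (fun i => r (M + 1 + i)) N q ↔
      signedWalk r (M + 1 + N) ((2 * k + b) * 2 ^ N + q) = 0 ∧
      (zeroTimes r (M + 1 + N) ((2 * k + b) * 2 ^ N + q)).ncard =
        (zeroTimes r M k).ncard + 1 := by
  have hN := signedWalk_concat r hb hq hk le_rfl
  simp only [Nat.sub_self, pow_zero, Nat.div_one] at hN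
  constructor
  · rintro ⟨-, h2, h3⟩
    have hz := hN.trans h2
    refine ⟨hz, ?_⟩
    rw [← ncard_insert_zeroTimes (N := N)]
    congr 1
    refine Set.Subset.antisymm ?_ (insert_zeroTimes_subset r hb hq hz)
    rintro j ⟨hj1, hj2, hj3⟩
    rcases le_or_gt j M with hjM | hjM
    · exact Or.inr ⟨hj1, hjM, by rwa [signedWalk_concat_of_le r hb hq hjM] at hj3⟩
    · obtain ⟨i, rfl⟩ := Nat.exists_eq_add_of_le (Nat.succ_le_of_lt hjM)
      left
      rw [Nat.succ_eq_add_one] at *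
      by_contra hne
      have hi : i < N := by omega
      rw [signedWalk_concat r hb hq hk hi.le] at hj3
      exact h3 i hi hj3
  · rintro ⟨hz, hcard⟩
    have heq := Set.eq_of_subset_of_ncard_le (insert_zeroTimes_subset r hb hq hz)
      (by rw [hcard, ncard_insert_zeroTimes]) (finite_zeroTimes _ _ _)
    refine ⟨hq, hN ▸ hz, fun j hj h => ?_⟩
    have hmem : M + 1 + j ∈ insert (M + 1 + N) (zeroTimes r M k) := by
      rw [heq]
      exact ⟨by omega, by omega, by rwa [signedWalk_concat r hb hq hk hj.le]⟩
    rcases hmem with h1 | h1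
    · omega
    · have := h1.2.1
      omega

end Concatenation

theorem exists_balancedPair_of_isFirstHit {r : ℕ → ℝ} (hr : ∀ n, r n = 1 ∨ r n = -1)
    {k m b N q : ℕ} (hp : BalancedPair r k m) (hb : b ≤ 1)
    (hq : IsFirstHit (r (2 * m) * (-1) ^ b) (fun i => r (2 * m + 1 + i)) N q) :
    ∃ k' m', BalancedPair r k' m' ∧ generation r k' m' = generation r k m + 1 ∧
      2 * m' = 2 * m + 1 + N ∧ k' = (2 * k + b) * 2 ^ N + q := by
  rw [balancedPair_iff] at hp
  have h := (isFirstHit_iff_ncard_zeroTimes r hb hq.1 hp.2).1 hq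
  obtain ⟨m', hm'⟩ := even_of_signedWalk_eq_zero hr h.1
  have hm : 2 * m' = 2 * m + 1 + N := by omega
  refine ⟨_, m', ?_, ?_, hm, rfl⟩
  · rw [balancedPair_iff, hm]
    refine ⟨?_, h.1⟩
    have h1 : (2 * k + b + 1) * 2 ^ N ≤ 2 ^ (2 * m + 1) * 2 ^ N :=
      Nat.mul_le_mul_right _ (by rw [pow_succ]; omega)
    rw [pow_add]
    linarith [hq.1]
  · rw [generation_eq_ncard, generation_eq_ncard, hm, h.2]

theorem mem_XtSet_iff {r : ℕ → ℝ} (hr : ∀ n, r n = 1 ∨ r n = -1) {k m b : ℕ}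
    (hp : BalancedPair r k m) (hb : b ≤ 1) {t : ℝ} (h0 : 0 ≤ t) (h1 : t ≤ 1) :
    (((2 * k + b : ℕ) : ℝ) + t) / 2 ^ (2 * m + 1) ∈ XtSet r k m (generation r k m) ↔
      Survives (r (2 * m) * (-1) ^ b) (fun i => r (2 * m + 1 + i)) t := by
  have hb' : (b : ℝ) ≤ 1 := by exact_mod_cast hb
  have hb0 : (0 : ℝ) ≤ b := by positivity
  have hP : (0 : ℝ) < 2 ^ (2 * m) := by positivity
  have hwalk := ((balancedPair_iff _ _ _).1 hp).2
  set x := (((2 * k + b : ℕ) : ℝ) + t) / 2 ^ (2 * m + 1) with hx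
  have hx' : 2 ^ (2 * m + 1) * x = ((2 * k + b : ℕ) : ℝ) + t := by rw [hx]; field_simp
  have hIcc : x ∈ Set.Icc ((k : ℝ) / 2 ^ (2 * m)) (((k : ℝ) + 1) / 2 ^ (2 * m)) := by
    rw [pow_succ] at hx'
    push_cast at hx'
    constructor
    · rw [div_le_iff₀ hP]; linarith
    · rw [le_div_iff₀ hP]; linarith
  have hIoo : ∀ k' m' : ℕ, x ∈ Set.Ioo ((k' : ℝ) / 2 ^ (2 * m')) (((k' : ℝ) + 1) / 2 ^ (2 * m')) ↔
      (k' : ℝ) < 2 ^ (2 * m') * x ∧ 2 ^ (2 * m') * x < k' + 1 := by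
    intro k' m'
    rw [Set.mem_Ioo, div_lt_iff₀' (by positivity), lt_div_iff₀' (by positivity)]
  have hscale : ∀ N : ℕ, (2 : ℝ) ^ (2 * m + 1 + N) * x = 2 ^ N * (((2 * k + b : ℕ) : ℝ) + t) := by
    intro N; rw [← hx', pow_add _ (2 * m + 1) N]; ring
  constructor
  · rintro ⟨-, h⟩
    refine ⟨h0, h1, fun N q hq hm => h ?_⟩
    obtain ⟨k', m', h2, h3, h4, h5⟩ := exists_balancedPair_of_isFirstHit hr hp hb hq
    refine Set.mem_iUnion.2 ⟨(k', m'), Set.mem_iUnion.2 ⟨⟨h2, h3⟩, ?_⟩⟩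
    rw [hIoo, h4, h5, hscale]
    push_cast
    exact ⟨by linarith [hm.1], by linarith [hm.2]⟩
  · rintro ⟨-, -, h⟩
    refine ⟨hIcc, fun hmem => ?_⟩
    obtain ⟨⟨k', m'⟩, hmem⟩ := Set.mem_iUnion.1 hmem
    obtain ⟨⟨h2, h3⟩, hmem⟩ := Set.mem_iUnion.1 hmem
    dsimp only at h2 h3 hmem
    rw [hIoo] at hmem
    rw [balancedPair_iff] at h2
    rw [generation_eq_ncard, generation_eq_ncard] at h3
    rcases le_or_gt m' m with hle | hlt
    · obtain ⟨e, he⟩ := Nat.exists_eq_add_of_le hle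
      have hpow : (2 : ℝ) ^ (2 * m + 1) = 2 ^ (2 * m') * 2 ^ (1 + 2 * e) := by
        rw [← pow_add, he]; ring_nf
      rw [hpow] at hx'
      have hE : (0 : ℝ) < 2 ^ (1 + 2 * e) := by positivity
      have h5 := div_two_pow_eq_of_mem (N := 1 + 2 * e) h0 h1
        (by rw [← hx']; nlinarith [mul_lt_mul_of_pos_right hmem.1 hE])
        (by rw [← hx']; nlinarith [mul_lt_mul_of_pos_right hmem.2 hE])
      rw [pow_add, pow_one, ← Nat.div_div_eq_div_mul, show (2 * k + b) / 2 = k by omega] at h5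
      have hsub : zeroTimes r (2 * m') k' ⊆ zeroTimes r (2 * m) k := by
        rintro j ⟨hj1, hj2, hj3⟩
        refine ⟨hj1, by omega, ?_⟩
        rwa [show 2 * m - j = 2 * e + (2 * m' - j) by omega, pow_add,
          ← Nat.div_div_eq_div_mul, h5]
      have := Set.ncard_le_ncard hsub (finite_zeroTimes _ _ _)
      omega
    · obtain ⟨N, hN⟩ := Nat.exists_eq_add_of_le (show 2 * m + 1 ≤ 2 * m' by omega)
      rw [hN, hscale] at hmem
      have hq := eq_div_two_pow_of_mem h0 h1 hmem.1 hmem.2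
      have hk' : (2 * k + b) * 2 ^ N + k' % 2 ^ N = k' := by
        rw [← hq]; exact Nat.div_add_mod' k' (2 ^ N)
      have hlt : k' % 2 ^ N < 2 ^ N := Nat.mod_lt _ (by positivity)
      rw [hN, ← hk'] at h2 h3
      refine h _ _ ((isFirstHit_iff_ncard_zeroTimes r hb hlt hwalk).2 ⟨h2.2, h3⟩) ?_
      have hkr : (k' : ℝ) = ((2 * k + b : ℕ) : ℝ) * 2 ^ N + (k' % 2 ^ N : ℕ) := by
        exact_mod_cast hk'.symm
      rw [hkr] at hmem
      exact ⟨by linarith [hmem.1], by linarith [hmem.2]⟩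

theorem exists_eq_of_mem_XtSet {r : ℕ → ℝ} {k m n : ℕ} {x : ℝ} (h : x ∈ XtSet r k m n) :
    ∃ b : ℕ, b ≤ 1 ∧ ∃ t : ℝ, 0 ≤ t ∧ t ≤ 1 ∧
      x = (((2 * k + b : ℕ) : ℝ) + t) / 2 ^ (2 * m + 1) := by
  obtain ⟨⟨hl, hu⟩, -⟩ := h
  rw [div_le_iff₀' (by positivity)] at hl
  rw [le_div_iff₀' (by positivity)] at hu
  obtain ⟨b, hb, t, h0, h1, ht⟩ := exists_half_eq (x := 2 ^ (2 * m) * x - k) (by linarith)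
    (by linarith)
  refine ⟨b, hb, t, h0, h1, ?_⟩
  rw [eq_div_iff (by positivity), pow_succ]
  push_cast
  linarith

theorem takagi_half_of_balancedPair {r : ℕ → ℝ} (hr : ∀ n, r n = 1 ∨ r n = -1) {k m b : ℕ}
    (hp : BalancedPair r k m) (hb : b ≤ 1) {t : ℝ} (h0 : 0 ≤ t) (h1 : t ≤ 1) :
    takagi r ((((2 * k + b : ℕ) : ℝ) + t) / 2 ^ (2 * m + 1)) = takagi r (k / 2 ^ (2 * m)) +
      (b * r (2 * m) + tiltedTakagi (r (2 * m) * (-1) ^ b) (fun i => r (2 * m + 1 + i)) t) /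
        2 ^ (2 * m + 1) := by
  have hwalk := ((balancedPair_iff _ _ _).1 hp).2
  have hz : (2 * k : ℝ) / 2 ^ (2 * m + 1) = k / 2 ^ (2 * m) := by
    rw [pow_succ]; field_simp
  have key := fun (b : ℕ) (hb : b ≤ 1) (t : ℝ) (h0 : 0 ≤ t) (h1 : t ≤ 1) =>
    takagi_add_div_two_pow hr (2 * m + 1) (2 * k + b) h0 h1
  simp only [tiltedTakagi]
  rw [key b hb t h0 h1, signedWalk_two_mul_add r hb hwalk]
  interval_cases b
  · simp [hz]
  · have h2 := key 0 zero_le_one 1 zero_le_one le_rfl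
    rw [signedWalk_two_mul_add r zero_le_one hwalk, add_zero, takagi_one] at h2
    push_cast at h2 ⊢
    rw [h2, hz]
    ring

/-- For a balanced pair `(k, m)` of generation `n`: (i) the image `f(X(x₀))` is
an interval of Lebesgue measure `(1/2)(1/4)^m`; (ii) if `y` is not the value of
`f` at the left endpoint of any balanced pair of generation `n + 1`, then the
level set of `y` meets `X(x₀)` in at most two points. -/
theorem truncated_hump_properties (r : ℕ → ℝ) (hr : ∀ n, r n = 1 ∨ r n = -1)
    (k m n : ℕ) (hb : BalancedPair r k m) (hgen : generation r k m = n) :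
    (∃ a : ℝ, takagi r '' XtSet r k m n = Set.Icc a (a + (1 / 2) * (1 / 4) ^ m)) ∧
    (∀ y : ℝ, (∀ k' m' : ℕ, BalancedPair r k' m' → generation r k' m' = n + 1 →
        takagi r ((k' : ℝ) / 2 ^ (2 * m')) ≠ y) →
      {x ∈ XtSet r k m n | takagi r x = y}.encard ≤ 2) := by
  subst hgen
  have hc := hr (2 * m)
  have hσ : ∀ b : ℕ, r (2 * m) * (-1) ^ b = 1 ∨ r (2 * m) * (-1) ^ b = -1 := by
    intro b
    rcases hc with h | h <;> rcases neg_one_pow_eq_or ℝ b with h2 | h2 <;> simp [h, h2]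
  have hr' : ∀ n, r (2 * m + 1 + n) = 1 ∨ r (2 * m + 1 + n) = -1 := fun n => hr _
  have hw : (1 / 2 * (1 / 4) ^ m : ℝ) = 1 / 2 ^ (2 * m + 1) := by
    rw [pow_succ, pow_mul, div_pow, one_pow]; norm_num
  have hP : (0 : ℝ) < 1 / 2 ^ (2 * m + 1) := by positivity
  constructor
  · have himage : ∀ y, y ∈ takagi r '' XtSet r k m (generation r k m) ↔ ∃ u, 0 ≤ u ∧ u ≤ 1 ∧
        y = takagi r (k / 2 ^ (2 * m)) + r (2 * m) * u * (1 / 2 ^ (2 * m + 1)) := by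
      intro y
      constructor
      · rintro ⟨x, hx, rfl⟩
        obtain ⟨b, hb1, t, h0, h1, rfl⟩ := exists_eq_of_mem_XtSet hx
        rw [mem_XtSet_iff hr hb hb1 h0 h1] at hx
        obtain ⟨u, hu0, hu1, hu⟩ := hx.exists_tiltedTakagi_eq_sign_mul (hσ b) hr'
        rw [takagi_half_of_balancedPair hr hb hb1 h0 h1, hu]
        interval_cases b
        · exact ⟨u, hu0, hu1, by push_cast; ring⟩
        · exact ⟨1 - u, by linarith, by linarith, by push_cast; ring⟩
      · rintro ⟨u, hu0, hu1, rfl⟩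
        obtain ⟨t, ht, htu⟩ := exists_survives_tiltedTakagi_eq_sign_mul (hσ 0) hr' hu0 hu1
        refine ⟨_, (mem_XtSet_iff hr hb zero_le_one ht.1 ht.2.1).2 ht, ?_⟩
        rw [takagi_half_of_balancedPair hr hb zero_le_one ht.1 ht.2.1, htu]
        push_cast
        ring
    rw [hw]
    generalize (1 : ℝ) / 2 ^ (2 * m + 1) = w at hP himage
    generalize takagi r (k / 2 ^ (2 * m)) = A at himage
    rcases hc with hc | hc <;> rw [hc] at himage
    · refine ⟨A, Set.ext fun y => (himage y).trans ⟨?_, ?_⟩⟩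
      · rintro ⟨u, hu0, hu1, rfl⟩
        constructor <;> nlinarith
      · rintro ⟨h1, h2⟩
        refine ⟨(y - A) / w, div_nonneg (by linarith) hP.le,
          (div_le_one hP).2 (by linarith), ?_⟩
        field_simp
        ring
    · refine ⟨A - w, Set.ext fun y => (himage y).trans ⟨?_, ?_⟩⟩
      · rintro ⟨u, hu0, hu1, rfl⟩
        constructor <;> nlinarith
      · rintro ⟨h1, h2⟩
        refine ⟨(A - y) / w, div_nonneg (by linarith) hP.le,
          (div_le_one hP).2 (by linarith), ?_⟩
        field_simp
        ring
  · intro y hy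
    set half : ℕ → Set ℝ := fun b => {x | ∃ t, 0 ≤ t ∧ t ≤ 1 ∧
      x = (((2 * k + b : ℕ) : ℝ) + t) / 2 ^ (2 * m + 1) ∧
      x ∈ XtSet r k m (generation r k m) ∧ takagi r x = y}
    have hsub : {x ∈ XtSet r k m (generation r k m) | takagi r x = y} ⊆ half 0 ∪ half 1 := by
      rintro x ⟨hx, hxy⟩
      obtain ⟨b, hb1, t, h0, h1, he⟩ := exists_eq_of_mem_XtSet hx
      interval_cases b
      · exact Or.inl ⟨t, h0, h1, he, hx, hxy⟩
      · exact Or.inr ⟨t, h0, h1, he, hx, hxy⟩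
    have hne : ∀ b ≤ 1, ∀ t t' : ℝ, 0 ≤ t → t' ≤ 1 → t < t' →
        (((2 * k + b : ℕ) : ℝ) + t) / 2 ^ (2 * m + 1) ∈ XtSet r k m (generation r k m) →
        (((2 * k + b : ℕ) : ℝ) + t') / 2 ^ (2 * m + 1) ∈ XtSet r k m (generation r k m) →
        takagi r ((((2 * k + b : ℕ) : ℝ) + t) / 2 ^ (2 * m + 1)) = y →
        takagi r ((((2 * k + b : ℕ) : ℝ) + t') / 2 ^ (2 * m + 1)) = y → False := by
      intro b hb1 t t' h0 h1' hlt hx hx' hty hty'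
      have h1 : t ≤ 1 := by linarith
      have h0' : 0 ≤ t' := by linarith
      rw [mem_XtSet_iff hr hb hb1 h0 h1] at hx
      rw [mem_XtSet_iff hr hb hb1 h0' h1'] at hx'
      rw [takagi_half_of_balancedPair hr hb hb1 h0 h1] at hty
      rw [takagi_half_of_balancedPair hr hb hb1 h0' h1'] at hty'
      have heq := hty.trans hty'.symm
      rw [add_right_inj, div_left_inj' (by positivity), add_right_inj] at heq
      obtain ⟨N, q, hq, hqs, hqt⟩ :=
        exists_isFirstHit_of_tiltedTakagi_eq (hσ b) hr' hx hx' hlt heq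
      obtain ⟨k', m', h2, h3, h4, h5⟩ := exists_balancedPair_of_isFirstHit hr hb hb1 hq
      refine hy k' m' h2 h3 ?_
      have hpt : (k' : ℝ) / 2 ^ (2 * m') =
          (((2 * k + b : ℕ) : ℝ) + q / 2 ^ N) / 2 ^ (2 * m + 1) := by
        rw [h4, h5, pow_add _ (2 * m + 1) N]
        push_cast
        field_simp
      rw [hpt, takagi_half_of_balancedPair hr hb hb1 hqs.1 hqs.2.1, hqt, hty]
    have hss : ∀ b ≤ 1, (half b).encard ≤ 1 := by
      intro b hb1
      rw [Set.encard_le_one_iff]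
      rintro x x' ⟨t, h0, h1, rfl, hx, hxy⟩ ⟨t', h0', h1', rfl, hx', hxy'⟩
      rcases lt_trichotomy t t' with hlt | rfl | hlt
      · exact (hne b hb1 t t' h0 h1' hlt hx hx' hxy hxy').elim
      · rfl
      · exact (hne b hb1 t' t h0' h1 hlt hx' hx hxy' hxy).elim
    calc _ ≤ (half 0 ∪ half 1).encard := Set.encard_le_encard hsub
      _ ≤ (half 0).encard + (half 1).encard := Set.encard_union_le _ _
      _ ≤ 1 + 1 := add_le_add (hss 0 zero_le_one) (hss 1 le_rfl)
      _ = 2 := one_add_one_eq_two
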